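/- Let r_1, …, r_N be distinct points of ℝ³, let q_1, …, q_N be real numbers, and let ε_i > 0, and define the Coulomb potential G(x) = Σ_{j=1}^N q_j / (ε_i ‖x − r_j‖) for x ∉ {r_1, …, r_N}. Let Ω ⊆ ℝ³ be open, let ε : Ω → ℝ be continuously differentiable, and let u_RF : Ω → ℝ be twice continuously differentiable and satisfy the regularized Poisson equation −∇·(ε ∇u_RF)(x) = ∇ε(x)·∇G(x) for every x ∈ Ω with x ∉ {r_1, …, r_N}. Then the recovered potential u = u_RF + G satisfies the homogeneous equation ∇·(ε ∇u)(x) = 0 for every x ∈ Ω with x ∉ {r_1, …, r_N}. -/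

import Mathlib

open scoped BigOperators RealInnerProductSpace

noncomputable section

/-- 3-dimensional Euclidean space. -/
abbrev E3 : Type := EuclideanSpace ℝ (Fin 3)

/-- The `k`-th standard basis vector of ℝ³. -/
def e3 (k : Fin 3) : E3 := EuclideanSpace.single k 1

/-- The divergence of a vector field `F : ℝ³ → ℝ³` at `x`:
`∇·F x = ∑ k, ∂F_k/∂x_k (x)`. -/
def div3 (F : E3 → E3) (x : E3) : ℝ :=
  ∑ k : Fin 3, ⟪fderiv ℝ F x (e3 k), e3 k⟫

theorem aux_norm (r y : E3) (h : y ≠ r) :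
    HasFDerivAt (fun z : E3 => ‖z - r‖) (‖y - r‖⁻¹ • innerSL ℝ (y - r)) y := by
  have hne : ‖y - r‖ ≠ 0 := norm_ne_zero_iff.2 (sub_ne_zero.2 h)
  have h1 : HasFDerivAt (fun z : E3 => ‖z - r‖ ^ 2) _ y :=
    ((hasFDerivAt_id y).sub_const r).norm_sq
  have h2 := h1.sqrt (by positivity)
  have h3 : (fun z : E3 => ‖z - r‖) = fun z => √(‖z - r‖ ^ 2) := by
    funext z; rw [Real.sqrt_sq (norm_nonneg _)]
  rw [h3]
  refine h2.congr_fderiv ?_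
  ext v
  simp [Real.sqrt_sq (norm_nonneg _)]
  field_simp

theorem aux_inv (r y : E3) (h : y ≠ r) (c e : ℝ) :
    HasGradientAt (fun z : E3 => c / (e * ‖z - r‖))
      ((-(c / e)) • ((‖y - r‖ ^ 3)⁻¹ • (y - r))) y := by
  have hne : ‖y - r‖ ≠ 0 := norm_ne_zero_iff.2 (sub_ne_zero.2 h)
  rw [hasGradientAt_iff_hasFDerivAt]
  have h2 := ((hasDerivAt_inv hne).comp_hasFDerivAt y (aux_norm r y h)).const_mul (c / e)
  have h3 : (fun z : E3 => c / (e * ‖z - r‖)) = fun z => (c / e) * ‖z - r‖⁻¹ := by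
    funext z; rw [← div_div, div_eq_mul_inv (c / e)]
  rw [h3]
  refine h2.congr_fderiv ?_
  ext v
  simp
  field_simp
  simp

theorem aux_cube (r y : E3) (h : y ≠ r) :
    HasFDerivAt (fun z : E3 => (‖z - r‖ ^ 3)⁻¹)
      ((-3 * (‖y - r‖ ^ 5)⁻¹) • innerSL ℝ (y - r)) y := by
  have hne : ‖y - r‖ ≠ 0 := norm_ne_zero_iff.2 (sub_ne_zero.2 h)
  have h2 := (((hasDerivAt_pow 3 ‖y - r‖).inv (by positivity))).comp_hasFDerivAt y (aux_norm r y h)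
  refine h2.congr_fderiv ?_
  ext v
  simp
  field_simp

theorem div3_eq {F : E3 → E3} {F' : E3 →L[ℝ] E3} {x : E3} (h : HasFDerivAt F F' x) :
    div3 F x = ∑ k : Fin 3, (F' (e3 k)) k := by
  simp [div3, h.fderiv, e3, EuclideanSpace.inner_single_right]

theorem div3_add {F H : E3 → E3} {x : E3} (hF : DifferentiableAt ℝ F x)
    (hH : DifferentiableAt ℝ H x) :
    div3 (fun y => F y + H y) x = div3 F x + div3 H x := by
  rw [div3_eq hF.hasFDerivAt, div3_eq hH.hasFDerivAt,
    div3_eq (hF.hasFDerivAt.fun_add hH.hasFDerivAt)]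
  simp [Finset.sum_add_distrib]

theorem div3_sum {N : ℕ} {F : Fin N → E3 → E3} {x : E3}
    (hF : ∀ j, DifferentiableAt ℝ (F j) x) :
    div3 (fun y => ∑ j, F j y) x = ∑ j, div3 (F j) x := by
  have h := HasFDerivAt.fun_sum (u := Finset.univ) fun j _ => (hF j).hasFDerivAt
  rw [div3_eq h]
  simp only [fun j => div3_eq (hF j).hasFDerivAt]
  rw [Finset.sum_comm]
  simp

theorem div3_smul {f : E3 → ℝ} {H : E3 → E3} {x : E3} (hf : DifferentiableAt ℝ f x)
    (hH : DifferentiableAt ℝ H x) :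
    div3 (fun y => f y • H y) x = f x * div3 H x + ⟪gradient f x, H x⟫ := by
  have h1 : ∀ v, fderiv ℝ f x v = ⟪gradient f x, v⟫ := by
    intro v
    rw [hf.hasGradientAt.hasFDerivAt.fderiv]; simp
  rw [div3_eq hH.hasFDerivAt, div3_eq (hf.hasFDerivAt.fun_smul hH.hasFDerivAt)]
  generalize gradient f x = g at h1 ⊢
  generalize fderiv ℝ f x = f' at h1 ⊢
  have h2 : ⟪g, H x⟫ = ∑ k, g k * H x k := by
    simp [PiLp.inner_apply, mul_comm]
  rw [h2]
  simp [h1, e3, EuclideanSpace.inner_single_right, Fin.sum_univ_three]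
  ring

theorem div3_const_smul (c : ℝ) {H : E3 → E3} {x : E3} (hH : DifferentiableAt ℝ H x) :
    div3 (fun y => c • H y) x = c * div3 H x := by
  rw [div3_eq hH.hasFDerivAt, div3_eq (hH.hasFDerivAt.fun_const_smul c)]
  simp [Finset.mul_sum]

theorem aux_diff (r x : E3) (h : x ≠ r) :
    DifferentiableAt ℝ (fun y : E3 => (‖y - r‖ ^ 3)⁻¹ • (y - r)) x :=
  ((aux_cube r x h).smul ((hasFDerivAt_id x).sub_const r)).differentiableAt

theorem aux_div (r x : E3) (h : x ≠ r) :
    div3 (fun y : E3 => (‖y - r‖ ^ 3)⁻¹ • (y - r)) x = 0 := by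
  have hne : ‖x - r‖ ≠ 0 := norm_ne_zero_iff.2 (sub_ne_zero.2 h)
  have hs := EuclideanSpace.real_norm_sq_eq (x - r)
  have key := div3_eq ((aux_cube r x h).smul ((hasFDerivAt_id x).sub_const r))
  refine Eq.trans key ?_
  simp [Fin.sum_univ_three, e3, EuclideanSpace.inner_single_right] at hs ⊢
  field_simp
  linear_combination 3 * hs

/-- **Recovery of the homogeneous equation from the regularized one.**
Let `r 1, …, r N` be distinct points of ℝ³, `q j` real charges, `εi > 0`, and
`G x = ∑ j, q j / (εi * ‖x - r j‖)` away from the charge centers.  Let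
`Ω ⊆ ℝ³` be open, `ε : Ω → ℝ` be `C¹` on `Ω`, and `u_RF : Ω → ℝ` be `C²` on
`Ω` satisfying the regularized Poisson equation
`-∇·(ε ∇u_RF) x = ∇ε x ⬝ ∇G x` for all `x ∈ Ω` away from the charge centers.
Then `u = u_RF + G` satisfies `∇·(ε ∇u) x = 0` for all such `x`. -/
theorem recovered_potential_homogeneous
    (N : ℕ) (r : Fin N → E3) (hr : Function.Injective r)
    (q : Fin N → ℝ) (εi : ℝ) (hεi : 0 < εi)
    (G : E3 → ℝ)
    (hG : ∀ x : E3, (∀ j, x ≠ r j) → G x = ∑ j, q j / (εi * ‖x - r j‖))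
    (Ω : Set E3) (hΩ : IsOpen Ω)
    (ε : E3 → ℝ) (hε : ContDiffOn ℝ 1 ε Ω)
    (uRF : E3 → ℝ) (huRF : ContDiffOn ℝ 2 uRF Ω)
    (heq : ∀ x ∈ Ω, (∀ j, x ≠ r j) →
      -div3 (fun y => ε y • gradient uRF y) x = ⟪gradient ε x, gradient G x⟫) :
    ∀ x ∈ Ω, (∀ j, x ≠ r j) →
      div3 (fun y => ε y • gradient (fun z => uRF z + G z) y) x = 0 := by
  intro x hx hxr
  have hev : ∀ᶠ y in nhds x, y ∈ Ω ∧ ∀ j, y ≠ r j :=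
    (hΩ.eventually_mem hx).and (Filter.eventually_all.2 fun j => isOpen_ne.eventually_mem (hxr j))
  set V : E3 → E3 := fun y => ∑ j, (-(q j / εi)) • ((‖y - r j‖ ^ 3)⁻¹ • (y - r j)) with hV
  have hGV : ∀ y, (∀ j, y ≠ r j) → HasGradientAt G (V y) y := by
    intro y hy
    have h1 : HasGradientAt (fun z => ∑ j, q j / (εi * ‖z - r j‖)) (V y) y := by
      rw [hasGradientAt_iff_hasFDerivAt, hV, map_sum]
      exact HasFDerivAt.fun_sum fun j _ => (aux_inv (r j) y (hy j) (q j) εi).hasFDerivAt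
    refine h1.congr_of_eventuallyEq ?_
    filter_upwards [Filter.eventually_all.2 fun j => isOpen_ne.eventually_mem (hy j)] with z hz
    exact hG z hz
  have hVj : ∀ j, DifferentiableAt ℝ
      (fun y => (-(q j / εi)) • ((‖y - r j‖ ^ 3)⁻¹ • (y - r j))) x :=
    fun j => (aux_diff (r j) x (hxr j)).fun_const_smul _
  have hVd : DifferentiableAt ℝ V x := DifferentiableAt.fun_sum fun j _ => hVj j
  have hVdiv : div3 V x = 0 := by
    rw [hV, div3_sum hVj]
    refine Finset.sum_eq_zero fun j _ => ?_
    rw [div3_const_smul _ (aux_diff (r j) x (hxr j)), aux_div _ _ (hxr j), mul_zero]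
  have hεd : DifferentiableAt ℝ ε x :=
    (hε.contDiffAt (hΩ.mem_nhds hx)).differentiableAt (by norm_num)
  have hgd : DifferentiableAt ℝ (gradient uRF) x := by
    have h1 : DifferentiableAt ℝ (fderiv ℝ uRF) x :=
      ((huRF.contDiffAt (hΩ.mem_nhds hx)).fderiv_right (m := 1) (by norm_num)).differentiableAt
        (by norm_num)
    exact ((InnerProductSpace.toDual ℝ E3).symm.toContinuousLinearEquiv.differentiableAt).comp x h1
  have hcongr : (fun y => ε y • gradient (fun z => uRF z + G z) y) =ᶠ[nhds x]
      fun y => ε y • gradient uRF y + ε y • V y := by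
    filter_upwards [hev] with y hy
    have h1 : DifferentiableAt ℝ uRF y :=
      (huRF.contDiffAt (hΩ.mem_nhds hy.1)).differentiableAt (by norm_num)
    have h2 : HasGradientAt (fun z => uRF z + G z) (gradient uRF y + V y) y := by
      rw [hasGradientAt_iff_hasFDerivAt, map_add]
      exact h1.hasGradientAt.hasFDerivAt.add (hGV y hy.2).hasFDerivAt
    rw [h2.gradient, smul_add]
  have h0 := heq x hx hxr
  rw [(hGV x hxr).gradient] at h0
  have h1 : div3 (fun y => ε y • gradient (fun z => uRF z + G z) y) x
      = div3 (fun y => ε y • gradient uRF y + ε y • V y) x := by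
    unfold div3
    rw [hcongr.fderiv_eq]
  rw [h1, div3_add (hεd.fun_smul hgd) (hεd.fun_smul hVd), div3_smul hεd hVd, hVdiv]
  linarith
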